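/- arXiv:2112.08568 — 2 statements merged into one kernel-verified Lean document; each statement's English description precedes it below -/
import Mathlib

section
/- Contour independence of the Mellin–Barnes representation of the GL(3) Whittaker function: Fix α = (α₁, α₂, α₃) ∈ ℂ³ with Re α₁ = Re α₂ = Re α₃ = 0 and α₁ + α₂ + α₃ = 0. Then for all y₀, y₁ > 0 and all σ₀, σ₁, σ₀′, σ₁′ > 0, the double integrals ∫_ℝ∫_ℝ G_α(σ₀+it₀, σ₁+it₁) y₀^{1−σ₀−it₀} y₁^{1−σ₁−it₁} dt₀ dt₁ and ∫_ℝ∫_ℝ G_α(σ₀′+it₀, σ₁′+it₁) y₀^{1−σ₀′−it₀} y₁^{1−σ₁′−it₁} dt₀ dt₁ both converge absolutely and are equal. -/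
open Complex MeasureTheory Set

/-- `Γ_ℝ(s) := π^{−s/2} Γ(s/2)`. -/
noncomputable def GammaR (s : ℂ) : ℂ := (Real.pi : ℂ) ^ (-s / 2) * Complex.Gamma (s / 2)

/-- The Mellin kernel `G_α(s₀,s₁)` of the GL(3) Whittaker function
(Vinogradov–Takhtadzhyan). -/
noncomputable def Gfun (α : Fin 3 → ℂ) (s0 s1 : ℂ) : ℂ :=
  (∏ i, GammaR (s0 + α i) * GammaR (s1 - α i)) / GammaR (s0 + s1)

/-- `‖Γ(s)‖ ≤ Γ(re s)` on the right half-plane. -/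
lemma norm_Gamma_le_Gamma_re {s : ℂ} (hs : 0 < s.re) :
    ‖Complex.Gamma s‖ ≤ Real.Gamma s.re := by
  rw [Complex.Gamma_eq_integral hs, Real.Gamma_eq_integral hs, Complex.GammaIntegral]
  refine norm_integral_le_of_norm_le (Real.GammaIntegral_convergent hs) ?_
  refine (ae_restrict_iff' measurableSet_Ioi).2 (.of_forall fun x hx => le_of_eq ?_)
  rw [norm_mul, Complex.norm_cpow_eq_rpow_re_of_pos hx, Complex.norm_real, Real.norm_eq_abs,
    abs_of_pos (Real.exp_pos _), Complex.sub_re, Complex.one_re]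

/-- Quadratic decay of `Γ` in a closed vertical strip of the right half-plane. -/
lemma exists_norm_Gamma_le {a : ℝ} (ha : 0 < a) (b : ℝ) :
    ∃ C, 0 ≤ C ∧ ∀ s : ℂ, a ≤ s.re → s.re ≤ b →
      ‖Complex.Gamma s‖ ≤ C * (1 + s.im ^ 2)⁻¹ := by
  have hcont : ContinuousOn Real.Gamma (Icc (a + 2) (b + 2)) := fun x hx =>
    (Real.differentiableAt_Gamma fun m => by
      have : (0 : ℝ) ≤ m := m.cast_nonneg
      linarith [hx.1]).continuousAt.continuousWithinAt
  obtain ⟨M, hM⟩ := isCompact_Icc.exists_bound_of_continuousOn hcont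
  refine ⟨|M| * (1 + 1 / a ^ 2), by positivity, fun s hs hs' => ?_⟩
  have hs0 : s ≠ 0 := fun h => by simp [h] at hs; linarith
  have hs1 : s + 1 ≠ 0 := fun h => by
    have := congrArg Complex.re h
    simp at this
    linarith
  have hrec : Complex.Gamma (s + 2) = (s + 1) * (s * Complex.Gamma s) := by
    rw [← Complex.Gamma_add_one s hs0, ← Complex.Gamma_add_one _ hs1]
    ring_nf
  have hM' : ‖Complex.Gamma (s + 2)‖ ≤ |M| := by
    have hre : (s + 2).re = s.re + 2 := by simp
    refine (norm_Gamma_le_Gamma_re (by rw [hre]; linarith)).trans ?_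
    rw [hre]
    exact (le_abs_self _).trans
      ((hM (s.re + 2) ⟨by linarith, by linarith⟩).trans (le_abs_self _))
  rw [hrec, norm_mul, norm_mul] at hM'
  have hsq : a ^ 2 + s.im ^ 2 ≤ ‖s‖ ^ 2 := by
    rw [Complex.sq_norm, Complex.normSq_apply]
    nlinarith
  have hle : ‖s‖ ≤ ‖s + 1‖ := by
    rw [← sq_le_sq₀ (norm_nonneg _) (norm_nonneg _), Complex.sq_norm, Complex.sq_norm,
      Complex.normSq_apply, Complex.normSq_apply]
    simp
    nlinarith
  have hprod : a ^ 2 + s.im ^ 2 ≤ ‖s + 1‖ * ‖s‖ := by nlinarith [norm_nonneg s]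
  have hK : 1 + s.im ^ 2 ≤ (1 + 1 / a ^ 2) * (a ^ 2 + s.im ^ 2) := by
    have : (1 + 1 / a ^ 2) * (a ^ 2 + s.im ^ 2) =
        1 + s.im ^ 2 + (a ^ 2 + s.im ^ 2 / a ^ 2) := by
      field_simp
      ring
    rw [this]
    exact le_add_of_nonneg_right (by positivity)
  rw [← div_eq_mul_inv, le_div_iff₀ (by positivity)]
  calc ‖Complex.Gamma s‖ * (1 + s.im ^ 2)
      ≤ ‖Complex.Gamma s‖ * ((1 + 1 / a ^ 2) * (‖s + 1‖ * ‖s‖)) := by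
        refine mul_le_mul_of_nonneg_left (hK.trans ?_) (norm_nonneg _)
        exact mul_le_mul_of_nonneg_left hprod (by positivity)
    _ = (‖s + 1‖ * (‖s‖ * ‖Complex.Gamma s‖)) * (1 + 1 / a ^ 2) := by ring
    _ ≤ |M| * (1 + 1 / a ^ 2) := mul_le_mul_of_nonneg_right hM' (by positivity)

/-- Positive-base complex powers are bounded in closed vertical strips. -/
lemma exists_norm_cpow_le {y : ℝ} (hy : 0 < y) (a b : ℝ) :
    ∃ C, 0 ≤ C ∧ ∀ s : ℂ, a ≤ s.re → s.re ≤ b → ‖(y : ℂ) ^ s‖ ≤ C := by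
  have hcont : ContinuousOn (fun x : ℝ => y ^ x) (Icc a b) :=
    (Real.continuous_const_rpow hy.ne').continuousOn
  obtain ⟨M, hM⟩ := isCompact_Icc.exists_bound_of_continuousOn hcont
  refine ⟨|M|, abs_nonneg _, fun s hs hs' => ?_⟩
  rw [Complex.norm_cpow_eq_rpow_re_of_pos hy]
  exact (le_abs_self _).trans ((hM _ ⟨hs, hs'⟩).trans (le_abs_self _))

/-- Quadratic decay of `Γ_ℝ`, shifted by an imaginary number, in a closed vertical strip. -/
lemma exists_norm_GammaR_add_le {a : ℝ} (ha : 0 < a) (b : ℝ) {c : ℂ} (hc : c.re = 0) :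
    ∃ C, 0 ≤ C ∧ ∀ s : ℂ, a ≤ s.re → s.re ≤ b →
      ‖GammaR (s + c)‖ ≤ C * (1 + s.im ^ 2)⁻¹ := by
  obtain ⟨C, hC0, hC⟩ := exists_norm_Gamma_le (half_pos ha) (b / 2)
  obtain ⟨D, hD0, hD⟩ := exists_norm_cpow_le Real.pi_pos (-b / 2) (-a / 2)
  refine ⟨D * (C * (8 + 2 * c.im ^ 2)), by positivity, fun s hs hs' => ?_⟩
  have hre : ((s + c) / 2).re = s.re / 2 := by simp [hc]
  have him : ((s + c) / 2).im = (s.im + c.im) / 2 := by simp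
  have hre' : (-(s + c) / 2).re = -s.re / 2 := by simp [hc]
  have hΓ := hC ((s + c) / 2) (by rw [hre]; linarith) (by rw [hre]; linarith)
  have hπ := hD (-(s + c) / 2) (by rw [hre']; linarith) (by rw [hre']; linarith)
  rw [GammaR, norm_mul, mul_assoc]
  refine mul_le_mul hπ (hΓ.trans ?_) (norm_nonneg _) hD0
  rw [him, mul_assoc]
  refine mul_le_mul_of_nonneg_left ?_ hC0
  rw [← div_eq_mul_inv, le_div_iff₀ (by positivity), inv_mul_le_iff₀ (by positivity)]
  nlinarith [sq_nonneg (s.im + 2 * c.im), sq_nonneg (c.im * (s.im + c.im))]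

/-- The Beta integral is bounded on products of right half-planes. -/
lemma exists_norm_betaIntegral_le {a : ℝ} (ha : 0 < a) :
    ∃ C, 0 ≤ C ∧ ∀ u v : ℂ, a ≤ u.re → a ≤ v.re → ‖Complex.betaIntegral u v‖ ≤ C := by
  have hnorm : ∀ u v : ℂ, ∀ x ∈ Ioo (0 : ℝ) 1,
      ‖(x : ℂ) ^ (u - 1) * (1 - (x : ℂ)) ^ (v - 1)‖ =
        x ^ (u.re - 1) * (1 - x) ^ (v.re - 1) := fun u v x hx => by
    rw [norm_mul, Complex.norm_cpow_eq_rpow_re_of_pos hx.1, ← Complex.ofReal_one,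
      ← Complex.ofReal_sub, Complex.norm_cpow_eq_rpow_re_of_pos (sub_pos.2 hx.2)]
    simp
  have hconv := (Complex.betaIntegral_convergent (u := a) (v := a) (by simpa) (by simpa)).norm
  refine ⟨∫ x : ℝ in 0..1, ‖(x : ℂ) ^ ((a : ℂ) - 1) * (1 - (x : ℂ)) ^ ((a : ℂ) - 1)‖,
    intervalIntegral.integral_nonneg zero_le_one fun _ _ => norm_nonneg _, fun u v hu hv => ?_⟩
  refine intervalIntegral.norm_integral_le_of_norm_le zero_le_one ?_ hconv
  filter_upwards [Measure.ae_ne volume (1 : ℝ)] with x hx1 hx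
  have hx' : x ∈ Ioo (0 : ℝ) 1 := ⟨hx.1, lt_of_le_of_ne hx.2 hx1⟩
  have hx'' : 0 < 1 - x := sub_pos.2 hx'.2
  rw [hnorm u v x hx', hnorm a a x hx', Complex.ofReal_re]
  refine mul_le_mul (Real.rpow_le_rpow_of_exponent_ge hx'.1 hx'.2.le (by linarith))
    (Real.rpow_le_rpow_of_exponent_ge hx'' (by linarith [hx'.1]) (by linarith))
    (Real.rpow_nonneg hx''.le _) (Real.rpow_nonneg hx'.1.le _)

lemma GammaR_mul_div_eq_betaIntegral {u v : ℂ} (hu : 0 < u.re) (hv : 0 < v.re) :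
    GammaR u * GammaR v / GammaR (u + v) = Complex.betaIntegral (u / 2) (v / 2) := by
  have hπ : (Real.pi : ℂ) ≠ 0 := Complex.ofReal_ne_zero.2 Real.pi_ne_zero
  rw [Complex.betaIntegral_eq_Gamma_mul_div _ _ (by simpa) (by simpa), GammaR, GammaR, GammaR,
    show -(u + v) / 2 = -u / 2 + -v / 2 by ring, Complex.cpow_add _ _ hπ, ← add_div]
  have h1 : (Real.pi : ℂ) ^ (-u / 2) ≠ 0 := by simp [Complex.cpow_eq_zero_iff, hπ]
  have h2 : (Real.pi : ℂ) ^ (-v / 2) ≠ 0 := by simp [Complex.cpow_eq_zero_iff, hπ]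
  rw [mul_mul_mul_comm, mul_div_mul_left _ _ (mul_ne_zero h1 h2)]

lemma differentiableAt_GammaR {s : ℂ} (hs : 0 < s.re) : DifferentiableAt ℂ GammaR s := by
  have hπ : (Real.pi : ℂ) ≠ 0 := Complex.ofReal_ne_zero.2 Real.pi_ne_zero
  have hΓ : DifferentiableAt ℂ Complex.Gamma (s / 2) :=
    Complex.differentiableAt_Gamma _ fun m h => by
      have hm : (0 : ℝ) ≤ m := m.cast_nonneg
      have := congrArg Complex.re h
      simp at this
      linarith
  unfold GammaR
  exact ((differentiableAt_id.neg.div_const 2).const_cpow (.inl hπ)).mul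
    (hΓ.comp s (differentiableAt_id.div_const 2))

lemma GammaR_ne_zero {s : ℂ} (hs : 0 < s.re) : GammaR s ≠ 0 :=
  Complex.Gammaℝ_ne_zero_of_re_pos hs

/-- The integrand of the Mellin–Barnes representation. -/
noncomputable def whittakerIntegrand (α : Fin 3 → ℂ) (y0 y1 : ℝ) (s0 s1 : ℂ) : ℂ :=
  Gfun α s0 s1 * (y0 : ℂ) ^ (1 - s0) * (y1 : ℂ) ^ (1 - s1)

lemma differentiableAt_whittakerIntegrand {α : Fin 3 → ℂ} (hre : ∀ i, (α i).re = 0)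
    {y0 y1 : ℝ} (hy0 : 0 < y0) (hy1 : 0 < y1) {p : ℂ × ℂ} (h0 : 0 < p.1.re) (h1 : 0 < p.2.re) :
    DifferentiableAt ℂ (fun p : ℂ × ℂ => whittakerIntegrand α y0 y1 p.1 p.2) p := by
  have hy0' : (y0 : ℂ) ≠ 0 := Complex.ofReal_ne_zero.2 hy0.ne'
  have hy1' : (y1 : ℂ) ≠ 0 := Complex.ofReal_ne_zero.2 hy1.ne'
  have hA : ∀ i, DifferentiableAt ℂ (fun p : ℂ × ℂ => GammaR (p.1 + α i)) p := fun i =>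
    DifferentiableAt.fun_comp' p (differentiableAt_GammaR (by simpa [hre i] using h0))
      (differentiableAt_fst.add_const _)
  have hB : ∀ i, DifferentiableAt ℂ (fun p : ℂ × ℂ => GammaR (p.2 - α i)) p := fun i =>
    DifferentiableAt.fun_comp' p (differentiableAt_GammaR (by simpa [hre i] using h1))
      (differentiableAt_snd.sub_const _)
  have hC : DifferentiableAt ℂ (fun p : ℂ × ℂ => GammaR (p.1 + p.2)) p :=
    DifferentiableAt.fun_comp' p (differentiableAt_GammaR (by simpa using add_pos h0 h1))
      (differentiableAt_fst.add differentiableAt_snd)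
  unfold whittakerIntegrand Gfun
  simp only [Fin.prod_univ_three, div_eq_mul_inv]
  have hP : DifferentiableAt ℂ (fun p : ℂ × ℂ => (y0 : ℂ) ^ (1 - p.1)) p :=
    (differentiableAt_fst.const_sub (1 : ℂ)).const_cpow (.inl hy0')
  have hQ : DifferentiableAt ℂ (fun p : ℂ × ℂ => (y1 : ℂ) ^ (1 - p.2)) p :=
    (differentiableAt_snd.const_sub (1 : ℂ)).const_cpow (.inl hy1')
  have hD : DifferentiableAt ℂ (fun p : ℂ × ℂ => (GammaR (p.1 + p.2))⁻¹) p :=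
    hC.fun_inv (GammaR_ne_zero (by simpa using add_pos h0 h1))
  exact ((((((hA 0).mul (hB 0)).mul ((hA 1).mul (hB 1))).mul ((hA 2).mul (hB 2))).mul
    hD).mul hP).mul hQ

/-- The integrand decays quadratically in both imaginary parts. -/
lemma exists_norm_whittakerIntegrand_le {α : Fin 3 → ℂ} (hre : ∀ i, (α i).re = 0)
    {y0 y1 : ℝ} (hy0 : 0 < y0) (hy1 : 0 < y1) {a : ℝ} (ha : 0 < a) (b : ℝ) :
    ∃ C, 0 ≤ C ∧ ∀ s0 s1 : ℂ, a ≤ s0.re → s0.re ≤ b → a ≤ s1.re → s1.re ≤ b →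
      ‖whittakerIntegrand α y0 y1 s0 s1‖ ≤ C * ((1 + s0.im ^ 2)⁻¹ * (1 + s1.im ^ 2)⁻¹) := by
  have hre' : ∀ i, (-α i).re = 0 := fun i => by simp [hre i]
  obtain ⟨B, hB0, hB⟩ := exists_norm_betaIntegral_le (half_pos ha)
  obtain ⟨C1, hC10, hC1⟩ := exists_norm_GammaR_add_le ha b (hre 1)
  obtain ⟨C2, hC20, hC2⟩ := exists_norm_GammaR_add_le ha b (hre 2)
  obtain ⟨D1, hD10, hD1⟩ := exists_norm_GammaR_add_le ha b (hre' 1)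
  obtain ⟨D2, hD20, hD2⟩ := exists_norm_GammaR_add_le ha b (hre' 2)
  obtain ⟨P, hP0, hP⟩ := exists_norm_cpow_le hy0 (1 - b) (1 - a)
  obtain ⟨Q, hQ0, hQ⟩ := exists_norm_cpow_le hy1 (1 - b) (1 - a)
  refine ⟨B * (C1 * D1) * (C2 * D2) * P * Q, by positivity, fun s0 s1 h0 h0' h1 h1' => ?_⟩
  have hinv : ∀ t : ℝ, (1 + t ^ 2)⁻¹ ≤ 1 := fun t => inv_le_one_of_one_le₀ (by nlinarith)
  have hC2' : ‖GammaR (s0 + α 2)‖ ≤ C2 :=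
    (hC2 s0 h0 h0').trans (mul_le_of_le_one_right hC20 (hinv _))
  have hD2' : ‖GammaR (s1 - α 2)‖ ≤ D2 :=
    (hD2 s1 h1 h1').trans (mul_le_of_le_one_right hD20 (hinv _))
  have hC1' := hC1 s0 h0 h0'
  have hD1' : ‖GammaR (s1 - α 1)‖ ≤ _ := hD1 s1 h1 h1'
  have hP' := hP (1 - s0) (by rw [sub_re, one_re]; linarith) (by rw [sub_re, one_re]; linarith)
  have hQ' := hQ (1 - s1) (by rw [sub_re, one_re]; linarith) (by rw [sub_re, one_re]; linarith)
  have hB' : ‖GammaR (s0 + α 0) * GammaR (s1 - α 0) / GammaR (s0 + s1)‖ ≤ B := by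
    have hu : (s0 + α 0).re = s0.re := by simp [hre]
    have hv : (s1 - α 0).re = s1.re := by simp [hre]
    rw [show s0 + s1 = (s0 + α 0) + (s1 - α 0) by ring,
      GammaR_mul_div_eq_betaIntegral (by linarith) (by linarith)]
    refine hB _ _ ?_ ?_
    · rw [Complex.div_ofNat_re, hu]
      linarith
    · rw [Complex.div_ofNat_re, hv]
      linarith
  have hfactor : whittakerIntegrand α y0 y1 s0 s1 =
      GammaR (s0 + α 0) * GammaR (s1 - α 0) / GammaR (s0 + s1) *
        (GammaR (s0 + α 1) * GammaR (s1 - α 1)) * (GammaR (s0 + α 2) * GammaR (s1 - α 2)) *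
        (y0 : ℂ) ^ (1 - s0) * (y1 : ℂ) ^ (1 - s1) := by
    rw [whittakerIntegrand, Gfun, Fin.prod_univ_three]
    ring
  calc ‖whittakerIntegrand α y0 y1 s0 s1‖
      ≤ B * ((C1 * (1 + s0.im ^ 2)⁻¹) * (D1 * (1 + s1.im ^ 2)⁻¹)) * (C2 * D2) * P * Q := by
        rw [hfactor, norm_mul, norm_mul, norm_mul, norm_mul, norm_mul (GammaR (s0 + α 1)),
          norm_mul (GammaR (s0 + α 2))]
        gcongr
    _ = _ := by ring

lemma integrable_whittakerIntegrand {α : Fin 3 → ℂ} (hre : ∀ i, (α i).re = 0)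
    {y0 y1 : ℝ} (hy0 : 0 < y0) (hy1 : 0 < y1) {σ0 σ1 : ℝ} (h0 : 0 < σ0) (h1 : 0 < σ1) :
    Integrable (fun p : ℝ × ℝ =>
      whittakerIntegrand α y0 y1 (σ0 + p.1 * I) (σ1 + p.2 * I)) := by
  obtain ⟨C, -, hC⟩ :=
    exists_norm_whittakerIntegrand_le hre hy0 hy1 (lt_min h0 h1) (max σ0 σ1)
  have hcont : Continuous (fun p : ℝ × ℝ =>
      whittakerIntegrand α y0 y1 (σ0 + p.1 * I) (σ1 + p.2 * I)) := by
    refine continuous_iff_continuousAt.2 fun p => ?_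
    have hd := (differentiableAt_whittakerIntegrand hre hy0 hy1
      (p := ((σ0 : ℂ) + p.1 * I, (σ1 : ℂ) + p.2 * I)) (by simpa) (by simpa)).continuousAt
    exact ContinuousAt.comp' (f := fun p : ℝ × ℝ => ((σ0 : ℂ) + p.1 * I, (σ1 : ℂ) + p.2 * I))
      hd (by fun_prop)
  refine ((integrable_inv_one_add_sq.mul_prod integrable_inv_one_add_sq).const_mul C).mono'
    hcont.aestronglyMeasurable (.of_forall fun p => ?_)
  simpa using hC (σ0 + p.1 * I) (σ1 + p.2 * I) (by simp) (by simp) (by simp) (by simp)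

/-- Shifting a vertical contour of integration through a strip in which the integrand is
holomorphic with quadratic decay. -/
lemma integral_vertical_eq_of_le {f : ℂ → ℂ} {a b C : ℝ} (hab : a ≤ b)
    (hf : ∀ s : ℂ, a ≤ s.re → s.re ≤ b → DifferentiableAt ℂ f s)
    (hC : ∀ s : ℂ, a ≤ s.re → s.re ≤ b → ‖f s‖ ≤ C * (1 + s.im ^ 2)⁻¹) :
    ∫ t : ℝ, f (a + t * I) = ∫ t : ℝ, f (b + t * I) := by
  have hint : ∀ σ : ℝ, a ≤ σ → σ ≤ b → Integrable fun t : ℝ => f (σ + t * I) := by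
    intro σ h h'
    have hcont : Continuous fun t : ℝ => f (σ + t * I) := continuous_iff_continuousAt.2 fun t =>
      ContinuousAt.comp' (f := fun t : ℝ => (σ : ℂ) + t * I)
        (hf (σ + t * I) (by simpa) (by simpa)).continuousAt (by fun_prop)
    refine (integrable_inv_one_add_sq.const_mul C).mono' hcont.aestronglyMeasurable
      (.of_forall fun t => ?_)
    simpa using hC (σ + t * I) (by simpa) (by simpa)
  have hlim : ∀ σ : ℝ, a ≤ σ → σ ≤ b → Filter.Tendsto
      (fun T : ℝ => ∫ t in -T..T, f (σ + t * I)) Filter.atTop (nhds (∫ t : ℝ, f (σ + t * I))) :=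
    fun σ h h' => intervalIntegral_tendsto_integral (hint σ h h')
      Filter.tendsto_neg_atTop_atBot Filter.tendsto_id
  have hedge : ∀ T : ℝ, ‖∫ x in a..b, f (x + T * I)‖ ≤ C * (1 + T ^ 2)⁻¹ * |b - a| := by
    refine fun T => intervalIntegral.norm_integral_le_of_norm_le_const fun x hx => ?_
    rw [uIoc_of_le hab] at hx
    simpa using hC (x + T * I) (by simpa using hx.1.le) (by simpa using hx.2)
  have hrect : ∀ T : ℝ, ‖(∫ t in -T..T, f (b + t * I)) - ∫ t in -T..T, f (a + t * I)‖ ≤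
      2 * (C * (1 + T ^ 2)⁻¹ * |b - a|) := by
    intro T
    have h := integral_boundary_rect_eq_zero_of_differentiableOn f (a + (-T : ℝ) * I) (b + T * I)
      fun s hs => by
        have h := hs.1
        simp [uIcc_of_le hab] at h
        exact (hf s h.1 h.2).differentiableWithinAt
    simp only [add_re, ofReal_re, mul_re, I_re, mul_zero, ofReal_im, I_im, mul_one, sub_self,
      add_zero, add_im, mul_im, zero_add, smul_eq_mul] at h
    have h' : I * ((∫ t in -T..T, f (b + t * I)) - ∫ t in -T..T, f (a + t * I)) =
        (∫ x in a..b, f (x + T * I)) - ∫ x in a..b, f (x + (-T : ℝ) * I) := by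
      linear_combination h
    have h'' := congrArg norm h'
    rw [norm_mul, norm_I, one_mul] at h''
    have hneg := hedge (-T)
    rw [neg_sq] at hneg
    rw [h'', two_mul]
    exact (norm_sub_le _ _).trans (add_le_add (hedge T) hneg)
  have hzero : Filter.Tendsto (fun T : ℝ => 2 * (C * (1 + T ^ 2)⁻¹ * |b - a|))
      Filter.atTop (nhds 0) := by
    have : Filter.Tendsto (fun T : ℝ => (1 + T ^ 2)⁻¹) Filter.atTop (nhds 0) :=
      (Filter.tendsto_atTop_add_const_left _ _
        (Filter.tendsto_pow_atTop two_ne_zero)).inv_tendsto_atTop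
    simpa using ((this.const_mul C).mul_const |b - a|).const_mul 2
  have hdiff := tendsto_nhds_unique
    ((hlim b hab le_rfl).sub (hlim a le_rfl hab)) (squeeze_zero_norm hrect hzero)
  exact (sub_eq_zero.1 hdiff).symm

/-- Shifting a vertical contour within the right half-plane. -/
lemma integral_vertical_eq {f : ℂ → ℂ} (hf : ∀ s : ℂ, 0 < s.re → DifferentiableAt ℂ f s)
    (hbound : ∀ a b : ℝ, 0 < a →
      ∃ C, ∀ s : ℂ, a ≤ s.re → s.re ≤ b → ‖f s‖ ≤ C * (1 + s.im ^ 2)⁻¹)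
    {σ σ' : ℝ} (hσ : 0 < σ) (hσ' : 0 < σ') :
    ∫ t : ℝ, f (σ + t * I) = ∫ t : ℝ, f (σ' + t * I) := by
  wlog h : σ ≤ σ' generalizing σ σ'
  · exact (this hσ' hσ (le_of_not_ge h)).symm
  obtain ⟨C, hC⟩ := hbound σ σ' hσ
  exact integral_vertical_eq_of_le h (fun s hs _ => hf s (hσ.trans_le hs)) hC

lemma integral_whittakerIntegrand_fst_eq {α : Fin 3 → ℂ} (hre : ∀ i, (α i).re = 0)
    {y0 y1 : ℝ} (hy0 : 0 < y0) (hy1 : 0 < y1) {σ σ' : ℝ} (hσ : 0 < σ) (hσ' : 0 < σ')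
    {s1 : ℂ} (h1 : 0 < s1.re) :
    ∫ t : ℝ, whittakerIntegrand α y0 y1 (σ + t * I) s1 =
      ∫ t : ℝ, whittakerIntegrand α y0 y1 (σ' + t * I) s1 := by
  refine integral_vertical_eq (f := fun s => whittakerIntegrand α y0 y1 s s1)
    (fun s hs => ?_) (fun a b ha => ?_) hσ hσ'
  · exact DifferentiableAt.fun_comp' (f := fun s : ℂ => (s, s1)) s
      (differentiableAt_whittakerIntegrand hre hy0 hy1 (p := (s, s1)) hs h1) (by fun_prop)
  · obtain ⟨C, -, hC⟩ :=
      exists_norm_whittakerIntegrand_le hre hy0 hy1 (lt_min ha h1) (max b s1.re)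
    refine ⟨C * (1 + s1.im ^ 2)⁻¹, fun s hs hs' => ?_⟩
    refine (hC s s1 (min_le_of_left_le hs) (le_max_of_le_left hs') (min_le_right _ _)
      (le_max_right _ _)).trans_eq (by ring)

lemma integral_whittakerIntegrand_snd_eq {α : Fin 3 → ℂ} (hre : ∀ i, (α i).re = 0)
    {y0 y1 : ℝ} (hy0 : 0 < y0) (hy1 : 0 < y1) {σ σ' : ℝ} (hσ : 0 < σ) (hσ' : 0 < σ')
    {s0 : ℂ} (h0 : 0 < s0.re) :
    ∫ t : ℝ, whittakerIntegrand α y0 y1 s0 (σ + t * I) =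
      ∫ t : ℝ, whittakerIntegrand α y0 y1 s0 (σ' + t * I) := by
  refine integral_vertical_eq (f := fun s => whittakerIntegrand α y0 y1 s0 s)
    (fun s hs => ?_) (fun a b ha => ?_) hσ hσ'
  · exact DifferentiableAt.fun_comp' (f := fun s : ℂ => (s0, s)) s
      (differentiableAt_whittakerIntegrand hre hy0 hy1 (p := (s0, s)) h0 hs) (by fun_prop)
  · obtain ⟨C, -, hC⟩ :=
      exists_norm_whittakerIntegrand_le hre hy0 hy1 (lt_min ha h0) (max b s0.re)
    refine ⟨C * (1 + s0.im ^ 2)⁻¹, fun s hs hs' => ?_⟩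
    refine (hC s0 s (min_le_right _ _) (le_max_right _ _) (min_le_of_left_le hs)
      (le_max_of_le_left hs')).trans_eq (by ring)

/-- Contour independence of the Mellin–Barnes representation of the GL(3) Whittaker
function: both double integrals converge absolutely and are equal, for any positive
abscissae. -/
theorem gl3_whittaker_contour_independence (α : Fin 3 → ℂ)
    (hre : ∀ i, (α i).re = 0) (hsum : α 0 + α 1 + α 2 = 0)
    (y0 y1 : ℝ) (hy0 : 0 < y0) (hy1 : 0 < y1)
    (σ0 σ1 σ0' σ1' : ℝ) (h0 : 0 < σ0) (h1 : 0 < σ1) (h0' : 0 < σ0') (h1' : 0 < σ1') :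
    Integrable (fun p : ℝ × ℝ =>
      Gfun α (σ0 + p.1 * I) (σ1 + p.2 * I) *
        (y0 : ℂ) ^ (1 - σ0 - p.1 * I) * (y1 : ℂ) ^ (1 - σ1 - p.2 * I)) ∧
    Integrable (fun p : ℝ × ℝ =>
      Gfun α (σ0' + p.1 * I) (σ1' + p.2 * I) *
        (y0 : ℂ) ^ (1 - σ0' - p.1 * I) * (y1 : ℂ) ^ (1 - σ1' - p.2 * I)) ∧
    (∫ t0 : ℝ, ∫ t1 : ℝ,
        Gfun α (σ0 + t0 * I) (σ1 + t1 * I) *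
          (y0 : ℂ) ^ (1 - σ0 - t0 * I) * (y1 : ℂ) ^ (1 - σ1 - t1 * I)) =
    (∫ t0 : ℝ, ∫ t1 : ℝ,
        Gfun α (σ0' + t0 * I) (σ1' + t1 * I) *
          (y0 : ℂ) ^ (1 - σ0' - t0 * I) * (y1 : ℂ) ^ (1 - σ1' - t1 * I)) := by
  have hint : ∀ {τ0 τ1 : ℝ}, 0 < τ0 → 0 < τ1 → Integrable (fun p : ℝ × ℝ =>
      whittakerIntegrand α y0 y1 (τ0 + p.1 * I) (τ1 + p.2 * I)) :=
    fun h h' => integrable_whittakerIntegrand hre hy0 hy1 h h'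
  simp only [sub_sub]
  refine ⟨hint h0 h1, hint h0' h1', ?_⟩
  calc ∫ t0 : ℝ, ∫ t1 : ℝ, whittakerIntegrand α y0 y1 (σ0 + t0 * I) (σ1 + t1 * I)
      = ∫ t0 : ℝ, ∫ t1 : ℝ, whittakerIntegrand α y0 y1 (σ0 + t0 * I) (σ1' + t1 * I) := by
        congr 1 with t0
        exact integral_whittakerIntegrand_snd_eq hre hy0 hy1 h1 h1' (by simpa)
    _ = ∫ t1 : ℝ, ∫ t0 : ℝ, whittakerIntegrand α y0 y1 (σ0 + t0 * I) (σ1' + t1 * I) :=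
        integral_integral_swap (hint h0 h1')
    _ = ∫ t1 : ℝ, ∫ t0 : ℝ, whittakerIntegrand α y0 y1 (σ0' + t0 * I) (σ1' + t1 * I) := by
        congr 1 with t1
        exact integral_whittakerIntegrand_fst_eq hre hy0 hy1 h0 h0' (by simpa)
    _ = ∫ t0 : ℝ, ∫ t1 : ℝ, whittakerIntegrand α y0 y1 (σ0' + t0 * I) (σ1' + t1 * I) :=
        (integral_integral_swap (hint h0' h1')).symm
end

section
/- Stade's formula for the GL(3)×GL(2) Rankin–Selberg integral: Fix α = (α₁, α₂, α₃) ∈ ℂ³ with Re α_i = 0 and α₁ + α₂ + α₃ = 0, and let μ ∈ ℂ be purely imaginary. Then for every s ∈ ℂ with Re s > 2, the double integral ∫₀^∞ ∫₀^∞ W_μ(y₁) · W_{−α}(y₀, y₁) · (y₀² y₁)^{s−1/2} dy₀ dy₁/(y₀ y₁²) converges absolutely and equals (1/4) · ∏_{k=1}^{3} Γ_ℝ(s + μ − α_k) Γ_ℝ(s − μ − α_k). -/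
open Complex MeasureTheory Set

/-- The K-Bessel function `K_μ(x) = ∫₀^∞ exp(−x cosh t) cosh(μt) dt`. -/
noncomputable def KBessel (μ : ℂ) (x : ℝ) : ℂ :=
  ∫ t in Ioi (0:ℝ), Complex.exp (-(x : ℂ) * (Real.cosh t : ℂ)) * Complex.cosh (μ * (t : ℂ))

/-- The GL(2) Whittaker function `W_μ(y) = 2√y K_μ(2πy)`. -/
noncomputable def W2 (μ : ℂ) (y : ℝ) : ℂ :=
  2 * (Real.sqrt y : ℂ) * KBessel μ (2 * Real.pi * y)

/-- The GL(3) Whittaker function, defined by its Mellin–Barnes integral on the lines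
`Re s₀ = Re s₁ = 1`. -/
noncomputable def W3 (α : Fin 3 → ℂ) (y0 y1 : ℝ) : ℂ :=
  (1 / 4) * (1 / (2 * (Real.pi : ℂ))) ^ 2 *
    ∫ t0 : ℝ, ∫ t1 : ℝ,
      Gfun α (1 + t0 * I) (1 + t1 * I) *
        (y0 : ℂ) ^ (-(t0 * I)) * (y1 : ℂ) ^ (-(t1 * I))

/-- `softplus t = ½ log (1 + e^{2t})`. -/
noncomputable def softplus (t : ℝ) : ℝ := Real.log (1 + Real.exp (2 * t)) / 2

lemma exp_two_mul_softplus (t : ℝ) : Real.exp (2 * softplus t) = 1 + Real.exp (2 * t) := by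
  rw [softplus, mul_div_cancel₀ _ two_ne_zero, Real.exp_log (by positivity)]

lemma continuous_softplus : Continuous softplus := by
  unfold softplus
  refine (Continuous.log (by fun_prop) fun t => ?_).div_const _
  positivity

/-- The exponential times a Gaussian in multiplicative coordinates, `e^{at} exp(−π e^{2t})`. -/
noncomputable def expGauss (a : ℂ) (t : ℝ) : ℂ :=
  cexp (a * t) * (Real.exp (-(Real.pi * Real.exp (2 * t))) : ℂ)

lemma continuous_expGauss (a : ℂ) : Continuous (expGauss a) := by
  unfold expGauss; fun_prop

lemma expGauss_ne_zero (a : ℂ) (t : ℝ) : expGauss a t ≠ 0 :=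
  mul_ne_zero (Complex.exp_ne_zero _) (by exact_mod_cast (Real.exp_pos _).ne')

lemma expGauss_add (a c : ℂ) (t : ℝ) : expGauss (a + c) t = cexp (c * t) * expGauss a t := by
  unfold expGauss
  rw [add_mul, Complex.exp_add]; ring

/-- Two Gaussians at distance `r` merge into a single one, displaced by `softplus r`. -/
lemma expGauss_mul_expGauss (a b : ℂ) (v r : ℝ) :
    expGauss a v * expGauss b (v + r) =
      cexp (b * r - (a + b) * softplus r) * expGauss (a + b) (v + softplus r) := by
  have h : Real.pi * Real.exp (2 * (v + softplus r)) =
      Real.pi * Real.exp (2 * v) + Real.pi * Real.exp (2 * (v + r)) := by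
    rw [mul_add 2 v, Real.exp_add, exp_two_mul_softplus, mul_add 2 v, Real.exp_add]; ring
  unfold expGauss
  rw [h, neg_add, Real.exp_add, ofReal_mul, ← mul_assoc, ← mul_assoc, ← Complex.exp_add]
  have : cexp (b * r - (a + b) * softplus r + (a + b) * ((v + softplus r : ℝ) : ℂ)) =
      cexp (a * v) * cexp (b * ((v + r : ℝ) : ℂ)) := by
    rw [← Complex.exp_add]; congr 1; push_cast; ring
  rw [this]; ring

lemma norm_expGauss (a : ℂ) (t : ℝ) : ‖expGauss a t‖ =
    Real.exp (a.re * t) * Real.exp (-(Real.pi * Real.exp (2 * t))) := by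
  rw [expGauss, norm_mul, Complex.norm_exp, norm_real, Real.norm_of_nonneg (Real.exp_pos _).le]
  simp

lemma norm_expGauss_le_one {a : ℂ} (ha : a.re = 1) (t : ℝ) : ‖expGauss a t‖ ≤ 1 := by
  rw [norm_expGauss, ha, ← Real.exp_add, Real.exp_le_one_iff]
  have h1 := Real.add_one_le_exp (2 * t)
  have h2 := Real.exp_pos (2 * t)
  nlinarith [Real.pi_gt_three]

lemma hasDerivAt_pi_mul_exp_two_mul (t : ℝ) :
    HasDerivAt (fun t => Real.pi * Real.exp (2 * t)) (2 * Real.pi * Real.exp (2 * t)) t := by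
  have h : HasDerivAt (fun t : ℝ => 2 * t) (2 * 1) t := (hasDerivAt_id t).const_mul 2
  exact (h.exp.const_mul Real.pi).congr_deriv (by ring)

lemma image_pi_mul_exp_two_mul : (fun t : ℝ => Real.pi * Real.exp (2 * t)) '' univ = Ioi 0 := by
  ext x
  simp only [image_univ, Set.mem_range, mem_Ioi]
  constructor
  · rintro ⟨t, rfl⟩; positivity
  · intro hx
    refine ⟨Real.log (x / Real.pi) / 2, ?_⟩
    rw [mul_div_cancel₀ _ two_ne_zero, Real.exp_log (by positivity)]
    field_simp

lemma pi_mul_exp_two_mul_injOn : InjOn (fun t : ℝ => Real.pi * Real.exp (2 * t)) univ := by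
  intro a _ b _ h
  simpa [Real.pi_ne_zero] using h

lemma gamma_integrand_comp (a : ℂ) (t : ℝ) :
    |2 * Real.pi * Real.exp (2 * t)| •
      (((Real.exp (-(Real.pi * Real.exp (2 * t))) : ℝ) : ℂ) *
        ((Real.pi * Real.exp (2 * t) : ℝ) : ℂ) ^ (a / 2 - 1)) =
      2 * (Real.pi : ℂ) ^ (a / 2) * expGauss a t := by
  have hx : (0 : ℝ) < Real.pi * Real.exp (2 * t) := by positivity
  have hx' : ((Real.pi * Real.exp (2 * t) : ℝ) : ℂ) ≠ 0 := by exact_mod_cast hx.ne'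
  have he : ((Real.pi * Real.exp (2 * t) : ℝ) : ℂ) ^ (a / 2) =
      (Real.pi : ℂ) ^ (a / 2) * cexp (a * t) := by
    rw [ofReal_mul, mul_cpow_ofReal_nonneg Real.pi_pos.le (Real.exp_pos _).le,
      cpow_def_of_ne_zero (x := (Real.exp (2 * t) : ℂ)) (by exact_mod_cast (Real.exp_pos _).ne'),
      ← ofReal_log (Real.exp_pos _).le, Real.log_exp]
    congr 2; push_cast; ring
  rw [cpow_sub _ _ hx', cpow_one, he, abs_of_pos (by positivity), real_smul, expGauss]
  have hp : (Real.pi : ℂ) ≠ 0 := by exact_mod_cast Real.pi_ne_zero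
  have h3 : (Real.exp (2 * t) : ℂ) ≠ 0 := by exact_mod_cast (Real.exp_pos _).ne'
  simp only [ofReal_mul, ofReal_ofNat]
  field_simp

lemma integrable_expGauss {a : ℂ} (ha : 0 < a.re) : Integrable (expGauss a) := by
  have h := Complex.GammaIntegral_convergent (s := a / 2) (by simpa using ha)
  rw [← image_pi_mul_exp_two_mul, integrableOn_image_iff_integrableOn_abs_deriv_smul
    MeasurableSet.univ (fun t _ => (hasDerivAt_pi_mul_exp_two_mul t).hasDerivWithinAt)
    pi_mul_exp_two_mul_injOn, integrableOn_univ] at h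
  simp only [gamma_integrand_comp] at h
  have hp : (2 * (Real.pi : ℂ) ^ (a / 2)) ≠ 0 := by
    simp [cpow_eq_zero_iff, Real.pi_ne_zero]
  exact (integrable_const_mul_iff (IsUnit.mk0 _ hp) _).1 h

lemma integral_expGauss {a : ℂ} (ha : 0 < a.re) : ∫ t, expGauss a t = GammaR a / 2 := by
  have h := Complex.Gamma_eq_integral (s := a / 2) (by simpa using ha)
  rw [Complex.GammaIntegral, ← image_pi_mul_exp_two_mul, integral_image_eq_integral_abs_deriv_smul
    MeasurableSet.univ (fun t _ => (hasDerivAt_pi_mul_exp_two_mul t).hasDerivWithinAt)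
    pi_mul_exp_two_mul_injOn, setIntegral_univ] at h
  simp only [gamma_integrand_comp] at h
  rw [integral_const_mul] at h
  have hp : (Real.pi : ℂ) ^ (a / 2) ≠ 0 := by
    simp [cpow_eq_zero_iff, Real.pi_ne_zero]
  rw [GammaR, h, neg_div, cpow_neg]
  field_simp

lemma GammaR_ne_zero_s9 {a : ℂ} (ha : 0 < a.re) : GammaR a ≠ 0 := by
  refine mul_ne_zero ?_ (Complex.Gamma_ne_zero_of_re_pos (by simpa using ha))
  simp [cpow_eq_zero_iff, Real.pi_ne_zero]

lemma norm_GammaR_le {a : ℂ} (ha : 0 < a.re) : ‖GammaR a‖ ≤ ‖GammaR a.re‖ := by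
  have key : ∫ t, ‖expGauss a t‖ = ‖∫ t, expGauss a.re t‖ := by
    have h : ∀ t, expGauss a.re t = ((‖expGauss a t‖ : ℝ) : ℂ) := fun t => by
      rw [norm_expGauss, expGauss]; push_cast; rfl
    simp only [h]
    rw [integral_complex_ofReal, norm_real, Real.norm_of_nonneg (integral_nonneg fun t => norm_nonneg _)]
  have h := norm_integral_le_integral_norm (μ := volume) (expGauss a)
  rw [key, integral_expGauss ha, integral_expGauss (by simpa using ha), norm_div, norm_div] at h
  exact (div_le_div_iff_of_pos_right (by simp)).1 h

/-- The functional equation `Γ_ℝ(a + 2) = a Γ_ℝ(a) / (2π)`. -/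
lemma GammaR_add_two {a : ℂ} (ha : a ≠ 0) : GammaR (a + 2) = a / (2 * Real.pi) * GammaR a := by
  have hp : (Real.pi : ℂ) ≠ 0 := by exact_mod_cast Real.pi_ne_zero
  rw [GammaR, GammaR, add_div, div_self two_ne_zero, Complex.Gamma_add_one _ (by simpa using ha),
    show -(a + 2) / 2 = -a / 2 - 1 by ring, cpow_sub _ _ hp, cpow_one]
  field_simp

/-- A translation by an amount depending on the base point preserves product measures. -/
lemma measurePreserving_shear {A A' G : Type*} [MeasurableSpace A] [MeasurableSpace A']
    [MeasurableSpace G] [AddGroup G] [MeasurableAdd₂ G] {μ : Measure A} {μ' : Measure A'}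
    {ν : Measure G} [SFinite μ] [SFinite ν] [ν.IsAddRightInvariant]
    {f : A → A'} (hf : MeasurePreserving f μ μ') {c : A → G} (hc : Measurable c) :
    MeasurePreserving (fun p : A × G => (f p.1, p.2 + c p.1)) (μ.prod ν) (μ'.prod ν) :=
  hf.skew_product (g := fun a x => x + c a) (by unfold Function.uncurry; fun_prop)
    (Filter.Eventually.of_forall fun a => (measurePreserving_add_right ν (c a)).map_eq)

/-- The kernel of the Beta integral in additive coordinates. -/
noncomputable def betaKernel (p q : ℂ) (t : ℝ) : ℂ := cexp (p * t - (p + q) * softplus t)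

lemma integral_comp_of_measurePreserving {A B : Type*} [MeasurableSpace A] [MeasurableSpace B]
    {μ : Measure A} {ν : Measure B} {T : A → B} (hT : MeasurePreserving T μ ν) {F : B → ℂ}
    (hF : Integrable F ν) : ∫ x, F (T x) ∂μ = ∫ y, F y ∂ν := by
  rw [← hT.map_eq] at hF ⊢
  exact (integral_map hT.measurable.aemeasurable hF.aestronglyMeasurable).symm

lemma integrable_betaKernel_and_integral {p q : ℂ} (hp : 0 < p.re) (hq : 0 < q.re) :
    Integrable (betaKernel p q) ∧
      ∫ t, betaKernel p q t = GammaR p * GammaR q / GammaR (p + q) / 2 := by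
  have hpq : 0 < (p + q).re := by rw [add_re]; positivity
  have hP : Integrable (fun z : ℝ × ℝ => expGauss q z.1 * expGauss p z.2)
      (volume.prod volume) := (integrable_expGauss hq).mul_prod (integrable_expGauss hp)
  have hT : MeasurePreserving (fun z : ℝ × ℝ => (z.2 - softplus z.1, z.2 - softplus z.1 + z.1))
      (volume.prod volume) (volume.prod volume) := by
    have h1 := measurePreserving_shear (ν := (volume : Measure ℝ))
      (MeasurePreserving.id (volume : Measure ℝ)) (c := fun r => -softplus r)
      continuous_softplus.measurable.neg
    have h2 := measurePreserving_shear (ν := (volume : Measure ℝ))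
      (MeasurePreserving.id (volume : Measure ℝ)) (c := fun r => r) measurable_id
    convert h2.comp ((Measure.measurePreserving_swap).comp h1) using 1
    ext z <;> simp [sub_eq_add_neg]; ring
  have hfun : ∀ z : ℝ × ℝ, expGauss q (z.2 - softplus z.1) *
      expGauss p (z.2 - softplus z.1 + z.1) = betaKernel p q z.1 * expGauss (p + q) z.2 := by
    intro z
    rw [expGauss_mul_expGauss, betaKernel, add_comm q p]
    simp
  have hI := hT.integrable_comp_of_integrable hP
  have hE := integral_comp_of_measurePreserving hT hP
  simp only [Function.comp_def, hfun] at hI hE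
  rw [integral_prod_mul, integral_prod_mul, integral_expGauss hpq, integral_expGauss hp,
    integral_expGauss hq] at hE
  constructor
  · obtain ⟨t, ht⟩ := hI.prod_left_ae.exists
    exact (integrable_mul_const_iff (IsUnit.mk0 _ (expGauss_ne_zero (p + q) t)) _).1 ht
  · have := GammaR_ne_zero_s9 hpq
    field_simp
    field_simp at hE
    linear_combination hE

/-- The additive convolution of two functions `expGauss`; up to a factor, a `K`-Bessel function. -/
noncomputable def gaussConv (a b : ℂ) (T : ℝ) : ℂ := ∫ u, expGauss a u * expGauss b (T - u)

lemma expGauss_mul_expGauss_sub_add (a b c : ℂ) (T u : ℝ) :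
    expGauss (a + c) u * expGauss (b + c) (T - u) =
      cexp (c * T) * (expGauss a u * expGauss b (T - u)) := by
  have h : cexp (c * T) = cexp (c * u) * cexp (c * ((T - u : ℝ) : ℂ)) := by
    rw [← Complex.exp_add]; congr 1; push_cast; ring
  rw [expGauss_add, expGauss_add, h]; ring

lemma gaussConv_add (a b c : ℂ) (T : ℝ) :
    gaussConv (a + c) (b + c) T = cexp (c * T) * gaussConv a b T := by
  simp only [gaussConv, expGauss_mul_expGauss_sub_add, integral_const_mul]

lemma gaussConv_eq_convolution (a b : ℂ) :
    gaussConv a b = convolution (expGauss a) (expGauss b) (ContinuousLinearMap.mul ℝ ℂ) volume :=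
  rfl

lemma integrable_gaussConv {a b : ℂ} (ha : 0 < a.re) (hb : 0 < b.re) :
    Integrable (gaussConv a b) :=
  (integrable_expGauss ha).integrable_convolution (ContinuousLinearMap.mul ℝ ℂ)
    (integrable_expGauss hb)

lemma integral_gaussConv {a b : ℂ} (ha : 0 < a.re) (hb : 0 < b.re) :
    ∫ T, gaussConv a b T = GammaR a * GammaR b / 4 := by
  rw [gaussConv_eq_convolution, integral_convolution _ (integrable_expGauss ha)
    (integrable_expGauss hb), integral_expGauss ha, integral_expGauss hb,
    ContinuousLinearMap.mul_apply']
  ring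

lemma continuous_gaussConv {a b : ℂ} (ha : a.re = 1) (hb : b.re = 1) :
    Continuous (gaussConv a b) := by
  refine BddAbove.continuous_convolution_right_of_integrable
    (ContinuousLinearMap.mul ℝ ℂ) ⟨1, ?_⟩
    (integrable_expGauss (by rw [ha]; exact one_pos)) (continuous_expGauss b)
  rintro _ ⟨t, rfl⟩
  exact norm_expGauss_le_one hb t

lemma integrable_expGauss_mul_expGauss_sub {a b : ℂ} (ha : a.re = 0) (hb : b.re = 0) (T : ℝ) :
    Integrable fun u => expGauss a u * expGauss b (T - u) := by
  have h : Integrable fun u => expGauss (b + 1) (T - u) * expGauss (a + 1) u := by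
    refine (integrable_expGauss (by simp [ha])).bdd_mul (c := 1) ?_ ?_
    · exact ((continuous_expGauss _).comp (by fun_prop)).aestronglyMeasurable
    · exact Filter.Eventually.of_forall fun u => norm_expGauss_le_one (by simp [hb]) _
  simp only [mul_comm (expGauss (b + 1) _), expGauss_mul_expGauss_sub_add] at h
  exact (integrable_const_mul_iff (IsUnit.mk0 _ (Complex.exp_ne_zero _)) _).1 h

lemma continuous_GammaR_vertical {a : ℂ} (ha : 0 < a.re) :
    Continuous fun t : ℝ => GammaR (a + t * I) := by
  have hre : ∀ t : ℝ, 0 < ((a + t * I) / 2).re := fun t => by simp [ha]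
  have hp : (Real.pi : ℂ) ≠ 0 := by exact_mod_cast Real.pi_ne_zero
  refine Continuous.mul (Continuous.const_cpow (by fun_prop) (Or.inl hp)) ?_
  refine continuous_iff_continuousAt.2 fun t => ?_
  refine ContinuousAt.comp (g := Complex.Gamma) (f := fun t : ℝ => (a + t * I) / 2)
    (Complex.differentiableAt_Gamma _ fun m hm => ?_).continuousAt (by fun_prop)
  have := hre t
  rw [hm] at this
  simp only [neg_re, natCast_re] at this
  linarith [Nat.cast_nonneg (α := ℝ) m]

lemma norm_GammaR_le_inv_one_add_sq {a : ℂ} (ha : a.re = 1) :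
    ‖GammaR a‖ ≤ (2 * Real.pi) ^ 2 * ‖GammaR 5‖ * (1 + a.im ^ 2)⁻¹ := by
  have h0 : a ≠ 0 := fun h => by simp [h] at ha
  have h2 : a + 2 ≠ 0 := fun h => by
    have := congrArg re h; simp [ha] at this; norm_num at this
  have h := GammaR_add_two h2
  rw [GammaR_add_two h0] at h
  have h5 : ‖GammaR (a + 2 + 2)‖ ≤ ‖GammaR 5‖ := by
    have hr : (a + 2 + 2).re = 5 := by simp [ha]; norm_num
    simpa [hr] using norm_GammaR_le (a := a + 2 + 2) (by rw [hr]; norm_num)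
  have hn1 : ‖a‖ ^ 2 = 1 + a.im ^ 2 := by rw [Complex.sq_norm, normSq_apply, ha]; ring
  have hn2 : ‖a + 2‖ ^ 2 = 9 + a.im ^ 2 := by
    rw [Complex.sq_norm, normSq_apply]; simp [ha]; ring
  have hle : ‖a‖ ≤ ‖a + 2‖ := by
    refine le_of_sq_le_sq ?_ (norm_nonneg _)
    rw [hn1, hn2]; linarith
  have hprod : 1 + a.im ^ 2 ≤ ‖a‖ * ‖a + 2‖ := by
    rw [← hn1, sq]; gcongr
  have hnorm := congrArg norm h
  simp only [norm_mul, norm_div, norm_real, norm_ofNat, Real.norm_eq_abs, abs_of_pos Real.pi_pos]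
    at hnorm
  have hpos : 0 < 1 + a.im ^ 2 := by positivity
  rw [← div_eq_mul_inv, le_div_iff₀ hpos]
  calc ‖GammaR a‖ * (1 + a.im ^ 2) ≤ ‖GammaR a‖ * (‖a‖ * ‖a + 2‖) := by gcongr
    _ = (2 * Real.pi) ^ 2 * ‖GammaR (a + 2 + 2)‖ := by
      rw [hnorm]; field_simp
    _ ≤ _ := by gcongr

lemma integrable_GammaR_vertical {a : ℂ} (ha : a.re = 1) :
    Integrable fun t : ℝ => GammaR (a + t * I) := by
  have h := ((integrable_inv_one_add_sq.comp_add_left a.im).const_mul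
    ((2 * Real.pi) ^ 2 * ‖GammaR 5‖))
  refine h.mono' (continuous_GammaR_vertical (by simp [ha])).aestronglyMeasurable
    (Filter.Eventually.of_forall fun t => ?_)
  simpa using norm_GammaR_le_inv_one_add_sq (a := a + t * I) (by simp [ha])

lemma integrable_GammaR_mul_GammaR_vertical {a b : ℂ} (ha : a.re = 1) (hb : b.re = 1) :
    Integrable fun t : ℝ => GammaR (a + t * I) * GammaR (b + t * I) := by
  refine (integrable_GammaR_vertical hb).bdd_mul (c := ‖GammaR 1‖)
    (continuous_GammaR_vertical (by simp [ha])).aestronglyMeasurable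
    (Filter.Eventually.of_forall fun t => ?_)
  simpa [ha] using norm_GammaR_le (a := a + t * I) (by simp [ha])

/-- Fourier inversion with the kernel `e^{itT}`. -/
lemma integral_exp_mul_eq_of_fourier {f F : ℝ → ℂ} (hf : Integrable f) (hc : Continuous f)
    (hF : Integrable F) (h : ∀ t : ℝ, F t = ∫ T : ℝ, cexp (t * I * T) * f T) (T : ℝ) :
    ∫ t : ℝ, F t * cexp (-(t * I) * T) = 2 * Real.pi * f T := by
  have hfour : ∀ w : ℝ, FourierTransform.fourier f w = F (-(2 * Real.pi) * w) := by
    intro w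
    rw [Real.fourier_eq', h]
    refine integral_congr_ae (Filter.Eventually.of_forall fun v => ?_)
    simp only [smul_eq_mul]
    congr 2
    simp only [RCLike.inner_apply, conj_trivial]
    push_cast; ring
  have hint : Integrable (FourierTransform.fourier f) := by
    rw [funext hfour]
    exact hF.comp_mul_left' (by simp [Real.pi_ne_zero])
  have hinv := hf.fourierInv_fourier_eq hint (v := T) hc.continuousAt
  rw [Real.fourierInv_eq'] at hinv
  have hsub := Measure.integral_comp_mul_left
    (fun t : ℝ => F t * cexp (-(t * I) * T)) (-(2 * Real.pi))
  have heq : ∀ w : ℝ, cexp (((2 * Real.pi * inner ℝ w T : ℝ) : ℂ) * I) •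
      FourierTransform.fourier f w = F (-(2 * Real.pi) * w) *
        cexp (-(((-(2 * Real.pi) * w : ℝ) : ℂ) * I) * T) := by
    intro w
    rw [hfour, smul_eq_mul, mul_comm]
    congr 2
    simp only [RCLike.inner_apply, conj_trivial]
    push_cast; ring
  simp only [heq] at hinv
  rw [hinv] at hsub
  have hp : (Real.pi : ℂ) ≠ 0 := by exact_mod_cast Real.pi_ne_zero
  rw [hsub, abs_inv, abs_neg, abs_of_pos Real.two_pi_pos, real_smul]
  push_cast
  rw [mul_inv_cancel_left₀ (mul_ne_zero two_ne_zero hp)]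

lemma integral_GammaR_mul_GammaR_vertical {a b : ℂ} (ha : a.re = 1) (hb : b.re = 1) (T : ℝ) :
    ∫ t : ℝ, GammaR (a + t * I) * GammaR (b + t * I) * cexp (-(t * I) * T) =
      8 * Real.pi * gaussConv a b T := by
  have ha' : 0 < a.re := by simp [ha]
  have hb' : 0 < b.re := by simp [hb]
  have h := integral_exp_mul_eq_of_fourier (f := fun T => 4 * gaussConv a b T)
    ((integrable_gaussConv ha' hb').const_mul 4) ((continuous_gaussConv ha hb).const_mul 4)
    (integrable_GammaR_mul_GammaR_vertical ha hb) (fun t => ?_) T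
  · rw [h]; ring
  · simp only [mul_left_comm _ (4 : ℂ), ← gaussConv_add]
    rw [integral_const_mul, integral_gaussConv (by simpa using ha') (by simpa using hb')]
    ring

lemma KBessel_eq_gaussConv {μ : ℂ} (hμ : μ.re = 0) (t : ℝ) :
    KBessel μ (2 * Real.pi * Real.exp t) = gaussConv μ (-μ) t := by
  set h : ℝ → ℂ := fun τ =>
    cexp (-((2 * Real.pi * Real.exp t : ℝ) : ℂ) * (Real.cosh τ : ℂ)) * cexp (μ * τ) with hh
  have hcomp : ∀ τ : ℝ, expGauss μ (2⁻¹ * (τ + t)) * expGauss (-μ) (t - 2⁻¹ * (τ + t)) = h τ := by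
    intro τ
    simp only [hh, expGauss, ofReal_exp]
    rw [mul_mul_mul_comm, ← Complex.exp_add, ← Complex.exp_add, mul_comm]
    congr 2
    · rw [show (2 * Real.pi * Real.exp t) = Real.pi * (2 * Real.exp t) by ring, Real.cosh_eq]
      rw [← ofReal_neg, ← ofReal_mul, ← ofReal_add]
      congr 1
      rw [show 2 * (2⁻¹ * (τ + t)) = t + τ by ring,
        show 2 * (t - 2⁻¹ * (τ + t)) = t + -τ by ring, Real.exp_add, Real.exp_add]
      ring
    · push_cast; ring
  have hint : Integrable h := by
    have h1 := ((integrable_expGauss_mul_expGauss_sub hμ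
      (show (-μ).re = 0 by simp [hμ]) t).comp_mul_left' (inv_ne_zero two_ne_zero)).comp_add_right t
    exact h1.congr (Filter.Eventually.of_forall hcomp)
  have hsub : ∫ τ, h τ = 2 * gaussConv μ (-μ) t := by
    rw [gaussConv, ← integral_congr_ae (Filter.Eventually.of_forall hcomp),
      integral_add_right_eq_self (fun x => expGauss μ (2⁻¹ * x) * expGauss (-μ) (t - 2⁻¹ * x)) t,
      Measure.integral_comp_mul_left (fun x => expGauss μ x * expGauss (-μ) (t - x)) 2⁻¹]
    simp
  have hsplit : ∫ τ, h τ = 2 * KBessel μ (2 * Real.pi * Real.exp t) := by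
    rw [← intervalIntegral.integral_Iic_add_Ioi (b := 0) hint.integrableOn hint.integrableOn,
      ← neg_zero, ← integral_comp_neg_Ioi, neg_zero, ← integral_add hint.comp_neg.integrableOn
        hint.integrableOn, KBessel, ← integral_const_mul]
    refine integral_congr_ae (Filter.Eventually.of_forall fun τ => ?_)
    simp only [hh, Real.cosh_neg, Complex.cosh, ofReal_neg, mul_neg]
    ring
  rw [hsub] at hsplit
  exact (mul_left_cancel₀ two_ne_zero hsplit).symm

lemma ofReal_exp_cpow (t : ℝ) (z : ℂ) : ((Real.exp t : ℝ) : ℂ) ^ z = cexp (t * z) := by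
  rw [cpow_def_of_ne_zero (by exact_mod_cast (Real.exp_pos _).ne'),
    ← ofReal_log (Real.exp_pos _).le, Real.log_exp]

lemma Gfun_eq_integral_betaKernel {α : Fin 3 → ℂ} {s0 s1 : ℂ}
    (h0 : 0 < (s0 + α 0).re) (h1 : 0 < (s1 - α 0).re) :
    Gfun α s0 s1 = (GammaR (s0 + α 1) * GammaR (s0 + α 2)) *
      (GammaR (s1 - α 1) * GammaR (s1 - α 2)) *
        (2 * ∫ ξ, betaKernel (s0 + α 0) (s1 - α 0) ξ) := by
  rw [(integrable_betaKernel_and_integral h0 h1).2, Gfun, Fin.prod_univ_three,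
    show s0 + α 0 + (s1 - α 0) = s0 + s1 by ring]
  ring

/-- The Vinogradov–Takhtajan type representation of the GL(3) Whittaker function. -/
lemma W3_exp_eq_integral {α : Fin 3 → ℂ} (hre : ∀ i, (α i).re = 0) (T0 T1 : ℝ) :
    W3 α (Real.exp T0) (Real.exp T1) =
      8 * ∫ ξ : ℝ, betaKernel (1 + α 0) (1 - α 0) ξ *
        (gaussConv (1 + α 1) (1 + α 2) (T0 + softplus ξ - ξ) *
          gaussConv (1 - α 1) (1 - α 2) (T1 + softplus ξ)) := by
  set F0 : ℝ → ℂ := fun t => GammaR (1 + α 1 + t * I) * GammaR (1 + α 2 + t * I) with hF0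
  set F1 : ℝ → ℂ := fun t => GammaR (1 - α 1 + t * I) * GammaR (1 - α 2 + t * I) with hF1
  have hF0i : Integrable F0 :=
    integrable_GammaR_mul_GammaR_vertical (by simp [hre]) (by simp [hre])
  have hF1i : Integrable F1 :=
    integrable_GammaR_mul_GammaR_vertical (by simp [hre]) (by simp [hre])
  have hbi : Integrable (betaKernel (1 + α 0) (1 - α 0)) :=
    (integrable_betaKernel_and_integral (by simp [hre]) (by simp [hre])).1
  set Ψ : (ℝ × ℝ) × ℝ → ℂ := fun z =>
    (F0 z.1.1 * cexp (-(z.1.1 * I) * ((T0 + softplus z.2 - z.2 : ℝ) : ℂ))) *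
      (F1 z.1.2 * cexp (-(z.1.2 * I) * ((T1 + softplus z.2 : ℝ) : ℂ))) *
        betaKernel (1 + α 0) (1 - α 0) z.2 with hΨ
  have hΨi : Integrable Ψ ((volume.prod volume).prod volume) := by
    have hsp := continuous_softplus
    have h := ((hF0i.mul_prod hF1i).mul_prod hbi).bdd_mul (c := 1)
      (f := fun z : (ℝ × ℝ) × ℝ =>
        cexp (((-(z.1.1 * (T0 + softplus z.2 - z.2)) - z.1.2 * (T1 + softplus z.2) : ℝ) : ℂ) * I))
      (by fun_prop) (Filter.Eventually.of_forall fun z => (norm_exp_ofReal_mul_I _).le)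
    refine h.congr (Filter.Eventually.of_forall fun z => ?_)
    have : cexp (((-(z.1.1 * (T0 + softplus z.2 - z.2)) -
        z.1.2 * (T1 + softplus z.2) : ℝ) : ℂ) * I) =
        cexp (-(z.1.1 * I) * ((T0 + softplus z.2 - z.2 : ℝ) : ℂ)) *
          cexp (-(z.1.2 * I) * ((T1 + softplus z.2 : ℝ) : ℂ)) := by
      rw [← Complex.exp_add]; congr 1; push_cast; ring
    simp only [hΨ, this]; ring
  have hpt : ∀ t0 t1 : ℝ, Gfun α (1 + t0 * I) (1 + t1 * I) *
      ((Real.exp T0 : ℝ) : ℂ) ^ (-(t0 * I)) * ((Real.exp T1 : ℝ) : ℂ) ^ (-(t1 * I)) =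
      2 * ∫ ξ, Ψ ((t0, t1), ξ) := by
    intro t0 t1
    rw [Gfun_eq_integral_betaKernel (by simp [hre]) (by simp [hre]), ofReal_exp_cpow,
      ofReal_exp_cpow]
    have hker : ∀ ξ, Ψ ((t0, t1), ξ) = F0 t0 * F1 t1 * (cexp (T0 * -(t0 * I)) *
        cexp (T1 * -(t1 * I))) * betaKernel (1 + t0 * I + α 0) (1 + t1 * I - α 0) ξ := by
      intro ξ
      have : cexp (-(t0 * I) * ((T0 + softplus ξ - ξ : ℝ) : ℂ)) *
          cexp (-(t1 * I) * ((T1 + softplus ξ : ℝ) : ℂ)) * betaKernel (1 + α 0) (1 - α 0) ξ =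
          cexp (T0 * -(t0 * I)) * cexp (T1 * -(t1 * I)) *
            betaKernel (1 + t0 * I + α 0) (1 + t1 * I - α 0) ξ := by
        simp only [betaKernel, ← Complex.exp_add]
        congr 1; push_cast; ring
      simp only [hΨ]
      linear_combination F0 t0 * F1 t1 * this
    simp only [hker, integral_const_mul, hF0, hF1]
    rw [show 1 + t0 * I + α 1 = 1 + α 1 + t0 * I by ring,
      show 1 + t0 * I + α 2 = 1 + α 2 + t0 * I by ring,
      show 1 + t1 * I - α 1 = 1 - α 1 + t1 * I by ring,
      show 1 + t1 * I - α 2 = 1 - α 2 + t1 * I by ring]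
    ring
  have hinner : ∀ ξ, ∫ z : ℝ × ℝ, Ψ (z, ξ) ∂(volume.prod volume) =
      (8 * Real.pi) ^ 2 * (betaKernel (1 + α 0) (1 - α 0) ξ *
        (gaussConv (1 + α 1) (1 + α 2) (T0 + softplus ξ - ξ) *
          gaussConv (1 - α 1) (1 - α 2) (T1 + softplus ξ))) := by
    intro ξ
    simp only [hΨ]
    rw [integral_mul_const, integral_prod_mul
      (fun t : ℝ => F0 t * cexp (-(t * I) * ((T0 + softplus ξ - ξ : ℝ) : ℂ)))
      (fun t : ℝ => F1 t * cexp (-(t * I) * ((T1 + softplus ξ : ℝ) : ℂ))),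
      integral_GammaR_mul_GammaR_vertical (by simp [hre]) (by simp [hre]),
      integral_GammaR_mul_GammaR_vertical (by simp [hre]) (by simp [hre])]
    ring
  have hp : (Real.pi : ℂ) ≠ 0 := by exact_mod_cast Real.pi_ne_zero
  rw [W3]
  simp only [hpt, integral_const_mul]
  rw [← integral_prod (fun z : ℝ × ℝ => ∫ ξ, Ψ (z, ξ)) hΨi.integral_prod_left,
    ← integral_prod _ hΨi, integral_prod_symm _ hΨi]
  simp only [hinner, integral_const_mul]
  field_simp
  norm_num

lemma softplus_eq_of_exp_eq {t x : ℝ} (h : Real.exp (2 * x) = 1 + Real.exp (2 * t)) :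
    softplus t = x := by
  rw [← exp_two_mul_softplus, Real.exp_eq_exp] at h
  linarith

lemma softplus_sub_softplus (ξ r : ℝ) :
    softplus (ξ - softplus r) = softplus (softplus ξ - r) + r - softplus r := by
  apply softplus_eq_of_exp_eq
  rw [mul_sub, mul_add, Real.exp_sub, Real.exp_add, exp_two_mul_softplus, mul_sub, mul_sub,
    Real.exp_sub, Real.exp_sub, exp_two_mul_softplus, exp_two_mul_softplus]
  have := Real.exp_pos (2 * r)
  field_simp
  ring

lemma softplus_add_sub_softplus (ξ r : ℝ) :
    softplus (r + (ξ - softplus r) - softplus (ξ - softplus r)) =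
      softplus ξ - softplus (ξ - softplus r) := by
  apply softplus_eq_of_exp_eq
  simp only [mul_sub, mul_add, Real.exp_sub, Real.exp_add, exp_two_mul_softplus]
  have := Real.exp_pos (2 * r)
  have := Real.exp_pos (2 * ξ)
  field_simp
  ring

/-- The change of variables which separates the four-fold integral behind Barnes' second lemma. -/
noncomputable def barnesMap (z : (ℝ × ℝ) × (ℝ × ℝ)) : (ℝ × ℝ) × (ℝ × ℝ) :=
  let r := z.2.2 - z.2.1
  let ζ := z.1.2 - softplus r
  ((ζ, z.1.1 - z.2.1 + softplus (softplus z.1.2 - r)),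
    (r + ζ - softplus ζ, z.2.1 + softplus r))

lemma measurePreserving_barnesMap : MeasurePreserving barnesMap
    ((volume.prod volume).prod (volume.prod volume))
    ((volume.prod volume).prod (volume.prod volume)) := by
  have hsp := continuous_softplus.measurable
  have hid := MeasurePreserving.id (volume : Measure ℝ)
  have h1 : MeasurePreserving (fun p : (ℝ × ℝ) × (ℝ × ℝ) =>
      ((p.1.2 + -p.1.1, p.1.1), p.2 + (-p.1.1, 0)))
      ((volume.prod volume).prod (volume.prod volume))
      ((volume.prod volume).prod (volume.prod volume)) :=
    measurePreserving_shear (f := fun x : ℝ × ℝ => (x.2 + -x.1, x.1))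
      (c := fun x : ℝ × ℝ => (-x.1, (0 : ℝ)))
      (Measure.measurePreserving_swap.comp
        (measurePreserving_shear (c := fun v : ℝ => -v) hid measurable_neg))
      (by fun_prop)
  have hfib : ∀ a : ℝ × ℝ, MeasurePreserving (fun c : ℝ × ℝ =>
      (c.2 + -softplus a.1, c.1 + softplus (softplus c.2 - a.1)))
      (volume.prod volume) (volume.prod volume) := fun a =>
    (measurePreserving_shear (c := fun ξ : ℝ => softplus (softplus ξ - a.1))
      (measurePreserving_add_right (volume : Measure ℝ) (-softplus a.1)) (by fun_prop)).comp
      Measure.measurePreserving_swap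
  have h2 : MeasurePreserving (fun p : (ℝ × ℝ) × (ℝ × ℝ) =>
      ((p.1.1, p.1.2 + softplus p.1.1),
        (p.2.2 + -softplus p.1.1, p.2.1 + softplus (softplus p.2.2 - p.1.1))))
      ((volume.prod volume).prod (volume.prod volume))
      ((volume.prod volume).prod (volume.prod volume)) :=
    (measurePreserving_shear (c := softplus) hid hsp).skew_product
      (g := fun (a c : ℝ × ℝ) => (c.2 + -softplus a.1, c.1 + softplus (softplus c.2 - a.1)))
      (by unfold Function.uncurry; fun_prop)
      (Filter.Eventually.of_forall fun a => (hfib a).map_eq)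
  have h3 : MeasurePreserving (fun p : (ℝ × ℝ) × (ℝ × ℝ) =>
      (p.1, p.2 + (p.1.1 - softplus p.1.1, 0)))
      ((volume.prod volume).prod (volume.prod volume))
      ((volume.prod volume).prod (volume.prod volume)) :=
    measurePreserving_shear (f := id) (c := fun x : ℝ × ℝ => (x.1 - softplus x.1, (0 : ℝ)))
      (MeasurePreserving.id _) (by fun_prop)
  have h := h3.comp (Measure.measurePreserving_swap.comp
    (h2.comp (h1.comp Measure.measurePreserving_swap)))
  convert h using 1
  funext z
  simp [barnesMap, sub_eq_add_neg, add_assoc]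

/-- The integrand which becomes a product of one-variable functions under `barnesMap`. -/
lemma barnes_integrand_eq {α₀ α₁ α₂ : ℂ} (hsum : α₀ + α₁ + α₂ = 0) (s μ : ℂ) (t ξ v u : ℝ) :
    cexp (α₀ * ξ + 2 * s * (ξ - softplus ξ) + s * t) *
      ((expGauss μ v * expGauss (-μ) (t - v)) *
        (expGauss (-α₁) u * expGauss (-α₂) (t + softplus ξ - u))) =
    (betaKernel (s + μ - α₂) (s - μ - α₀) (barnesMap ((t, ξ), (v, u))).1.1 *
      expGauss (s - μ - α₂) (barnesMap ((t, ξ), (v, u))).1.2) *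
    (betaKernel (s - μ - α₁) (s + μ - α₀) (barnesMap ((t, ξ), (v, u))).2.1 *
      expGauss (s + μ - α₁) (barnesMap ((t, ξ), (v, u))).2.2) := by
  obtain ⟨r, rfl⟩ : ∃ r, u = v + r := ⟨u - v, by ring⟩
  obtain ⟨w, rfl⟩ : ∃ w, t = w + v := ⟨t - v, by ring⟩
  obtain rfl : α₀ = -α₁ - α₂ := by linear_combination hsum
  have e1 : s - μ - α₂ = -μ + -α₂ + s := by ring
  have e2 : s + μ - α₁ = μ + -α₁ + s := by ring
  have hv := expGauss_mul_expGauss μ (-α₁) v r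
  have hw := expGauss_mul_expGauss (-μ) (-α₂) w (softplus ξ - r)
  simp only [barnesMap, add_sub_cancel_left, add_sub_cancel_right]
  rw [show w + v + softplus ξ - (v + r) = w + (softplus ξ - r) by ring]
  calc _ = cexp ((-α₁ - α₂) * ξ + 2 * s * (ξ - softplus ξ) + s * ((w + v : ℝ) : ℂ)) *
      ((expGauss μ v * expGauss (-α₁) (v + r)) *
        (expGauss (-μ) w * expGauss (-α₂) (w + (softplus ξ - r)))) := by ring
    _ = _ := by
      rw [hv, hw, e1, e2, expGauss_add _ s, expGauss_add _ s]
      have key : cexp ((-α₁ - α₂) * ξ + 2 * s * (ξ - softplus ξ) + s * ((w + v : ℝ) : ℂ)) *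
          cexp (-α₁ * r - (μ + -α₁) * softplus r) *
          cexp (-α₂ * ((softplus ξ - r : ℝ) : ℂ) - (-μ + -α₂) * softplus (softplus ξ - r)) =
          betaKernel (s + μ - α₂) (s - μ - (-α₁ - α₂)) (ξ - softplus r) *
          betaKernel (-μ + -α₁ + s) (s + μ - (-α₁ - α₂))
            (r + (ξ - softplus r) - softplus (ξ - softplus r)) *
          cexp (s * ((w + softplus (softplus ξ - r) : ℝ) : ℂ)) *
          cexp (s * ((v + softplus r : ℝ) : ℂ)) := by
        simp only [betaKernel, ← Complex.exp_add]
        rw [softplus_add_sub_softplus, softplus_sub_softplus]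
        congr 1; push_cast; ring
      rw [show s - μ - α₁ = -μ + -α₁ + s by ring]
      linear_combination (expGauss (μ + -α₁) (v + softplus r) *
        expGauss (-μ + -α₂) (w + softplus (softplus ξ - r))) * key

/-- Barnes' second lemma as a real double integral. -/
lemma integrable_barnes_and_integral {α₀ α₁ α₂ s μ : ℂ} (hsum : α₀ + α₁ + α₂ = 0)
    (h₀ : α₀.re = 0) (h₁ : α₁.re = 0) (h₂ : α₂.re = 0) (hμ : μ.re = 0) (hs : 0 < s.re) :
    Integrable (fun z : ℝ × ℝ => cexp (α₀ * z.2 + 2 * s * (z.2 - softplus z.2) + s * z.1) *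
      (gaussConv μ (-μ) z.1 * gaussConv (-α₁) (-α₂) (z.1 + softplus z.2)))
      (volume.prod volume) ∧
    ∫ z : ℝ × ℝ, cexp (α₀ * z.2 + 2 * s * (z.2 - softplus z.2) + s * z.1) *
      (gaussConv μ (-μ) z.1 * gaussConv (-α₁) (-α₂) (z.1 + softplus z.2))
        ∂(volume.prod volume) =
      (GammaR (s + μ - α₀) * GammaR (s - μ - α₀)) * (GammaR (s + μ - α₁) * GammaR (s - μ - α₁)) *
        (GammaR (s + μ - α₂) * GammaR (s - μ - α₂)) /
          (16 * (GammaR (2 * s + α₁) * GammaR (2 * s + α₂))) := by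
  have hβ₁ := integrable_betaKernel_and_integral (p := s + μ - α₂) (q := s - μ - α₀)
    (by simp [*]) (by simp [*])
  have hβ₂ := integrable_betaKernel_and_integral (p := s - μ - α₁) (q := s + μ - α₀)
    (by simp [*]) (by simp [*])
  have hr₁ : 0 < (s - μ - α₂).re := by simp [*]
  have hr₂ : 0 < (s + μ - α₁).re := by simp [*]
  have hP := (hβ₁.1.mul_prod (integrable_expGauss hr₁)).mul_prod
    (hβ₂.1.mul_prod (integrable_expGauss hr₂))
  have hI := measurePreserving_barnesMap.integrable_comp_of_integrable hP
  have hE := integral_comp_of_measurePreserving measurePreserving_barnesMap hP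
  have hslice : ∀ x : ℝ × ℝ, ∫ y : ℝ × ℝ,
      (betaKernel (s + μ - α₂) (s - μ - α₀) (barnesMap (x, y)).1.1 *
        expGauss (s - μ - α₂) (barnesMap (x, y)).1.2) *
      (betaKernel (s - μ - α₁) (s + μ - α₀) (barnesMap (x, y)).2.1 *
        expGauss (s + μ - α₁) (barnesMap (x, y)).2.2) ∂(volume.prod volume) =
      cexp (α₀ * x.2 + 2 * s * (x.2 - softplus x.2) + s * x.1) *
        (gaussConv μ (-μ) x.1 * gaussConv (-α₁) (-α₂) (x.1 + softplus x.2)) := by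
    rintro ⟨t, ξ⟩
    rw [gaussConv, gaussConv, ← integral_prod_mul, ← integral_const_mul]
    refine integral_congr_ae (Filter.Eventually.of_forall fun y => ?_)
    exact (barnes_integrand_eq hsum s μ t ξ y.1 y.2).symm
  rw [integral_prod _ (by exact hI)] at hE
  have hI' := hI.integral_prod_left
  simp only [Function.comp_def, hslice] at hI' hE
  refine ⟨hI', ?_⟩
  rw [hE, integral_prod_mul (fun x : ℝ × ℝ => betaKernel (s + μ - α₂) (s - μ - α₀) x.1 *
      expGauss (s - μ - α₂) x.2) (fun x : ℝ × ℝ => betaKernel (s - μ - α₁) (s + μ - α₀) x.1 *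
      expGauss (s + μ - α₁) x.2), integral_prod_mul, integral_prod_mul, hβ₁.2, hβ₂.2,
    integral_expGauss hr₁, integral_expGauss hr₂,
    show s + μ - α₂ + (s - μ - α₀) = 2 * s + α₁ by linear_combination -hsum,
    show s - μ - α₁ + (s + μ - α₀) = 2 * s + α₂ by linear_combination -hsum]
  ring

lemma image_exp_univ : Real.exp '' univ = Ioi 0 := by
  rw [image_univ, Real.range_exp]

lemma integral_Ioi_eq_integral_exp (F : ℝ → ℂ) :
    ∫ y in Ioi (0 : ℝ), F y = ∫ t : ℝ, (Real.exp t : ℂ) * F (Real.exp t) := by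
  rw [← image_exp_univ, integral_image_eq_integral_abs_deriv_smul MeasurableSet.univ
    (fun t _ => (Real.hasDerivAt_exp t).hasDerivWithinAt) Real.exp_injective.injOn,
    setIntegral_univ]
  simp only [Real.abs_exp, real_smul]

lemma measurePreserving_exp : MeasurePreserving Real.exp
    (volume.withDensity fun t => ENNReal.ofReal (Real.exp t)) (volume.restrict (Ioi 0)) := by
  refine ⟨Real.measurable_exp, ?_⟩
  ext s hs
  have h := lintegral_image_eq_lintegral_abs_deriv_mul MeasurableSet.univ
    (fun t _ => (Real.hasDerivAt_exp t).hasDerivWithinAt) Real.exp_injective.injOn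
    (s.indicator 1)
  rw [image_exp_univ, lintegral_indicator_one hs, Measure.restrict_univ] at h
  rw [h, Measure.map_apply Real.measurable_exp hs,
    withDensity_apply _ (Real.measurable_exp hs), ← lintegral_indicator (Real.measurable_exp hs)]
  congr 1
  ext t
  by_cases ht : Real.exp t ∈ s <;> simp [ht, indicator]

lemma integrableOn_Ioi_prod_Ioi_of_exp {F : ℝ × ℝ → ℂ}
    (h : Integrable (fun t : ℝ × ℝ => (Real.exp t.1 : ℂ) * ((Real.exp t.2 : ℂ) *
      F (Real.exp t.1, Real.exp t.2))) (volume.prod volume)) :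
    IntegrableOn F (Ioi 0 ×ˢ Ioi 0) := by
  have hemb : MeasurableEmbedding Real.exp :=
    Real.continuous_exp.measurableEmbedding Real.exp_injective
  rw [IntegrableOn, Measure.volume_eq_prod, ← Measure.prod_restrict,
    ← (measurePreserving_exp.prod measurePreserving_exp).integrable_comp_emb (hemb.prodMap hemb),
    prod_withDensity (by fun_prop) (by fun_prop),
    integrable_withDensity_iff_integrable_smul' (by fun_prop)
      (Filter.Eventually.of_forall fun z => by finiteness)]
  refine h.congr (Filter.Eventually.of_forall fun t => ?_)
  simp [ENNReal.toReal_mul, ENNReal.toReal_ofReal (Real.exp_pos _).le, real_smul, mul_assoc, Prod.map]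

/-- The integrand of Stade's formula in exponential coordinates. -/
lemma stade_integrand_exp {α : Fin 3 → ℂ} (hre : ∀ i, (α i).re = 0) {μ : ℂ} (hμ : μ.re = 0)
    (s : ℂ) (t0 t1 : ℝ) :
    (Real.exp t0 : ℂ) * ((Real.exp t1 : ℂ) * (W2 μ (Real.exp t1) *
      W3 α (Real.exp t0) (Real.exp t1) *
      ((Real.exp t0 ^ 2 * Real.exp t1 : ℝ) : ℂ) ^ (s - 1/2) /
        ((Real.exp t0 * Real.exp t1 ^ 2 : ℝ) : ℂ))) =
    16 * ∫ ξ : ℝ, gaussConv (2 * s + α 1) (2 * s + α 2) (t0 + (softplus ξ - ξ)) *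
      (cexp (α 0 * ξ + 2 * s * (ξ - softplus ξ) + s * t1) *
      (gaussConv μ (-μ) t1 * gaussConv (-α 1) (-α 2) (t1 + softplus ξ))) := by
  have hsqrt : Real.sqrt (Real.exp t1) = Real.exp (t1 / 2) := (Real.exp_half t1).symm
  have hpow : Real.exp t0 ^ 2 * Real.exp t1 = Real.exp (2 * t0 + t1) := by
    rw [Real.exp_add, ← Real.exp_nat_mul]; norm_num
  have hden : Real.exp t0 * Real.exp t1 ^ 2 = Real.exp (t0 + 2 * t1) := by
    rw [Real.exp_add, ← Real.exp_nat_mul]; norm_num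
  rw [W2, KBessel_eq_gaussConv hμ, W3_exp_eq_integral hre, hsqrt, hpow, hden, ofReal_exp_cpow]
  have hpt : ∀ ξ : ℝ, gaussConv (2 * s + α 1) (2 * s + α 2) (t0 + (softplus ξ - ξ)) *
      (cexp (α 0 * ξ + 2 * s * (ξ - softplus ξ) + s * t1) *
      (gaussConv μ (-μ) t1 * gaussConv (-α 1) (-α 2) (t1 + softplus ξ))) =
      (cexp (2 * (s - 1 / 2) * t0 + (s - 1) * t1) * gaussConv μ (-μ) t1) *
      (betaKernel (1 + α 0) (1 - α 0) ξ *
        (gaussConv (1 + α 1) (1 + α 2) (t0 + softplus ξ - ξ) *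
          gaussConv (1 - α 1) (1 - α 2) (t1 + softplus ξ))) := by
    intro ξ
    rw [show 2 * s + α 1 = α 1 + 2 * s by ring, show 2 * s + α 2 = α 2 + 2 * s by ring,
      show 1 - α 1 = -α 1 + 1 by ring, show 1 - α 2 = -α 2 + 1 by ring, add_comm 1 (α 1),
      add_comm 1 (α 2), gaussConv_add, gaussConv_add, gaussConv_add, add_sub_assoc t0]
    have key : cexp (2 * s * ((t0 + (softplus ξ - ξ) : ℝ) : ℂ)) *
        cexp (α 0 * ξ + 2 * s * (ξ - softplus ξ) + s * t1) =
        cexp (2 * (s - 1 / 2) * t0 + (s - 1) * t1) * betaKernel (1 + α 0) (1 - α 0) ξ *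
        cexp (1 * ((t0 + (softplus ξ - ξ) : ℝ) : ℂ)) * cexp (1 * ((t1 + softplus ξ : ℝ) : ℂ)) := by
      simp only [betaKernel, ← Complex.exp_add]
      congr 1; push_cast; ring
    linear_combination (gaussConv (α 1) (α 2) (t0 + (softplus ξ - ξ)) * gaussConv μ (-μ) t1 *
      gaussConv (-α 1) (-α 2) (t1 + softplus ξ)) * key
  simp only [hpt, integral_const_mul]
  set J := ∫ ξ : ℝ, betaKernel (1 + α 0) (1 - α 0) ξ *
        (gaussConv (1 + α 1) (1 + α 2) (t0 + softplus ξ - ξ) *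
          gaussConv (1 - α 1) (1 - α 2) (t1 + softplus ξ))
  have key : (Real.exp t0 : ℂ) * Real.exp t1 * Real.exp (t1 / 2) *
      cexp (((2 * t0 + t1 : ℝ) : ℂ) * (s - 1 / 2)) / (Real.exp (t0 + 2 * t1) : ℂ) =
      cexp (2 * (s - 1 / 2) * t0 + (s - 1) * t1) := by
    simp only [ofReal_exp]
    rw [← Complex.exp_add, ← Complex.exp_add, ← Complex.exp_add, ← Complex.exp_sub]
    congr 1; push_cast; ring
  rw [← key]; ring

lemma stade_integrable_and_integral {α : Fin 3 → ℂ} (hre : ∀ i, (α i).re = 0)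
    (hsum : α 0 + α 1 + α 2 = 0) {μ : ℂ} (hμ : μ.re = 0) {s : ℂ} (hs : 0 < s.re) :
    Integrable (fun z : (ℝ × ℝ) × ℝ =>
      gaussConv (2 * s + α 1) (2 * s + α 2) (z.1.1 + (softplus z.2 - z.2)) *
      (cexp (α 0 * z.2 + 2 * s * (z.2 - softplus z.2) + s * z.1.2) *
      (gaussConv μ (-μ) z.1.2 * gaussConv (-α 1) (-α 2) (z.1.2 + softplus z.2))))
      ((volume.prod volume).prod volume) ∧
    ∫ z : (ℝ × ℝ) × ℝ,
      gaussConv (2 * s + α 1) (2 * s + α 2) (z.1.1 + (softplus z.2 - z.2)) *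
      (cexp (α 0 * z.2 + 2 * s * (z.2 - softplus z.2) + s * z.1.2) *
      (gaussConv μ (-μ) z.1.2 * gaussConv (-α 1) (-α 2) (z.1.2 + softplus z.2)))
      ∂((volume.prod volume).prod volume) =
    (∏ k, GammaR (s + μ - α k) * GammaR (s - μ - α k)) / 64 := by
  have hB := integrable_barnes_and_integral hsum (hre 0) (hre 1) (hre 2) hμ hs
  have h₁ : 0 < (2 * s + α 1).re := by simp [hre, hs]
  have h₂ : 0 < (2 * s + α 2).re := by simp [hre, hs]
  have hP := (integrable_gaussConv h₁ h₂).mul_prod hB.1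
  have hT : MeasurePreserving
      (fun z : (ℝ × ℝ) × ℝ => (z.1.1 + (softplus z.2 - z.2), (z.1.2, z.2)))
      ((volume.prod volume).prod volume) (volume.prod (volume.prod volume)) := by
    have hsp := continuous_softplus.measurable
    have h := measurePreserving_shear (ν := (volume : Measure ℝ))
      (c := fun x : ℝ × ℝ => softplus x.2 - x.2)
      (MeasurePreserving.id ((volume : Measure ℝ).prod (volume : Measure ℝ))) (by fun_prop)
    exact Measure.measurePreserving_swap.comp (h.comp (Measure.measurePreserving_swap.comp
      (measurePreserving_prodAssoc volume volume volume)))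
  refine ⟨hT.integrable_comp_of_integrable hP, ?_⟩
  refine (integral_comp_of_measurePreserving hT hP).trans ?_
  rw [integral_prod_mul (gaussConv (2 * s + α 1) (2 * s + α 2)) (fun z : ℝ × ℝ =>
      cexp (α 0 * z.2 + 2 * s * (z.2 - softplus z.2) + s * z.1) *
        (gaussConv μ (-μ) z.1 * gaussConv (-α 1) (-α 2) (z.1 + softplus z.2))), hB.2, integral_gaussConv h₁ h₂,
    Fin.prod_univ_three]
  have g₁ := GammaR_ne_zero_s9 h₁
  have g₂ := GammaR_ne_zero_s9 h₂
  field_simp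
  ring

/-- Stade's formula for the GL(3)×GL(2) Rankin–Selberg integral. -/
theorem stade_formula (α : Fin 3 → ℂ)
    (hre : ∀ i, (α i).re = 0) (hsum : α 0 + α 1 + α 2 = 0)
    (μ : ℂ) (hμ : μ.re = 0) (s : ℂ) (hs : 2 < s.re) :
    IntegrableOn (fun p : ℝ × ℝ =>
      W2 μ p.2 * W3 α p.1 p.2 * ((p.1 ^ 2 * p.2 : ℝ) : ℂ) ^ (s - 1/2) /
        ((p.1 * p.2 ^ 2 : ℝ) : ℂ)) (Ioi 0 ×ˢ Ioi 0) ∧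
    ∫ y0 in Ioi (0:ℝ), ∫ y1 in Ioi (0:ℝ),
        W2 μ y1 * W3 α y0 y1 * ((y0 ^ 2 * y1 : ℝ) : ℂ) ^ (s - 1/2) /
          ((y0 * y1 ^ 2 : ℝ) : ℂ) =
      (1 / 4) * ∏ k, GammaR (s + μ - α k) * GammaR (s - μ - α k) := by
  obtain ⟨hI, hE⟩ := stade_integrable_and_integral hre hsum hμ (s := s) (by linarith)
  have hI' : Integrable (fun t : ℝ × ℝ => (Real.exp t.1 : ℂ) * ((Real.exp t.2 : ℂ) *
      (W2 μ (Real.exp t.2) * W3 α (Real.exp t.1) (Real.exp t.2) *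
        ((Real.exp t.1 ^ 2 * Real.exp t.2 : ℝ) : ℂ) ^ (s - 1/2) /
          ((Real.exp t.1 * Real.exp t.2 ^ 2 : ℝ) : ℂ)))) (volume.prod volume) := by
    simp only [stade_integrand_exp hre hμ]
    exact hI.integral_prod_left.const_mul 16
  refine ⟨integrableOn_Ioi_prod_Ioi_of_exp hI', ?_⟩
  simp only [integral_Ioi_eq_integral_exp, ← integral_const_mul]
  rw [← integral_prod _ hI']
  simp only [stade_integrand_exp hre hμ]
  rw [integral_const_mul, ← integral_prod _ hI, hE]
  ring
end
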